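/- Fix a ∈ [−1,1], μ > 0, γ > 1, τ > 0 and T > 0. Let (v, u, S) be a solution of the relaxed system on [0,T] × ℝ with v > 0, (v − 1, u, S) ∈ C⁰([0,T]; H²(ℝ)) ∩ C¹([0,T]; H¹(ℝ)). Then for all t ∈ (0,T), in the distributional sense in t, d/dt ∫_ℝ ( u²/2 + (τ v/(2μ)) S² + (v^{1−γ} − 1)/(γ − 1) + v − 1 ) dx + ∫_ℝ (v/μ) S² dx = ((4a + 1)τ/(2μ)) ∫_ℝ (∂_x u) S² dx. -/

import Mathlib

open MeasureTheory Filter Set intervalIntegral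

noncomputable section

/-- Squared `H^k(ℝ)` norm: sum of the squared `L²` norms of the derivatives up to order `k`. -/
def HSq (k : ℕ) (f : ℝ → ℝ) : ℝ :=
  ∑ j ∈ Finset.range (k + 1), ∫ x : ℝ, (iteratedDeriv j f x) ^ 2

/-- Classical membership in `H^k(ℝ)`. -/
def MemH (k : ℕ) (f : ℝ → ℝ) : Prop :=
  ContDiff ℝ k f ∧ ∀ j ≤ k, Integrable fun x => (iteratedDeriv j f x) ^ 2

/-- Partial derivative in time. -/
def pt (f : ℝ → ℝ → ℝ) (t x : ℝ) : ℝ := deriv (fun s => f s x) t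

/-- Partial derivative in space. -/
def px (f : ℝ → ℝ → ℝ) (t x : ℝ) : ℝ := deriv (f t) x

/-- Continuity of `t ↦ f t` as an `H^k`-valued map on `I`. -/
def ContH (k : ℕ) (I : Set ℝ) (f : ℝ → ℝ → ℝ) : Prop :=
  ∀ s ∈ I, Tendsto (fun t => HSq k fun x => f t x - f s x) (nhdsWithin s I) (nhds 0)

/-- `f ∈ C⁰(I; H^k) ∩ C¹(I; H^(k-1))`. -/
def RegH (k : ℕ) (I : Set ℝ) (f : ℝ → ℝ → ℝ) : Prop :=
  (∀ t ∈ I, MemH k (f t)) ∧ ContH k I f ∧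
  (∀ x, ∀ t ∈ I, DifferentiableAt ℝ (fun s => f s x) t) ∧
  (∀ t ∈ I, MemH (k - 1) fun x => pt f t x) ∧ ContH (k - 1) I fun t x => pt f t x

/-- The 1-d isentropic compressible Navier–Stokes system with Oldroyd-type constitutive
law, in Lagrangian coordinates, at a point `(t, x)`:
`v_t = u_x`, `u_t + (v^(-γ))_x = S_x`, `τ (S_t - (2 a S / v) u_x) + S = μ u_x / v`. -/
def RelaxedSystem (a μ γ τ : ℝ) (v u S : ℝ → ℝ → ℝ) (t x : ℝ) : Prop :=
  pt v t x = px u t x ∧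
  pt u t x + deriv (fun y => v t y ^ (-γ)) x = px S t x ∧
  τ * (pt S t x - 2 * a * S t x / v t x * px u t x) + S t x = μ * px u t x / v t x

/-- The energy functional `E(t)`. -/
def En (τ : ℝ) (v u S : ℝ → ℝ → ℝ) (t : ℝ) : ℝ :=
  sSup ((fun s => HSq 2 (fun x => v s x - 1) + HSq 2 (u s) + τ * HSq 2 (S s)) '' Icc 0 t)

/-- The dissipation functional `D(t)`. -/
def Dn (v u S : ℝ → ℝ → ℝ) (t : ℝ) : ℝ :=
  HSq 1 (fun x => px v t x) + HSq 1 (fun x => px u t x) + HSq 2 (S t)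

/-- A solution of the relaxed system on `[0,T] × ℝ` in the class
`C⁰([0,T]; H²) ∩ C¹([0,T]; H¹)` with `v > 0` and `2τaS + μ > 0`. -/
def IsSolOn (a μ γ τ T : ℝ) (v u S : ℝ → ℝ → ℝ) : Prop :=
  (∀ t ∈ Icc (0 : ℝ) T, ∀ x : ℝ,
      0 < v t x ∧ 0 < 2 * τ * a * S t x + μ ∧ RelaxedSystem a μ γ τ v u S t x) ∧
  RegH 2 (Icc 0 T) (fun t x => v t x - 1) ∧ RegH 2 (Icc 0 T) u ∧ RegH 2 (Icc 0 T) S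


lemma HSq_one (f : ℝ → ℝ) : HSq 1 f = (∫ x, f x ^ 2) + ∫ x, deriv f x ^ 2 := by
  simp [HSq, Finset.sum_range_succ]

lemma HSq_mono {k l : ℕ} (h : k ≤ l) (f : ℝ → ℝ) : HSq k f ≤ HSq l f :=
  Finset.sum_le_sum_of_subset_of_nonneg (Finset.range_mono (by omega))
    fun _ _ _ => integral_nonneg fun _ => sq_nonneg _

lemma HSq_nonneg (k : ℕ) (f : ℝ → ℝ) : 0 ≤ HSq k f :=
  Finset.sum_nonneg fun _ _ => integral_nonneg fun _ => sq_nonneg _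

lemma MemH.mono {k l : ℕ} (h : k ≤ l) {f : ℝ → ℝ} (hf : MemH l f) : MemH k f :=
  ⟨hf.1.of_le (by exact_mod_cast h), fun j hj => hf.2 j (hj.trans h)⟩

lemma ContH.mono {k l : ℕ} (h : k ≤ l) {I : Set ℝ} {f : ℝ → ℝ → ℝ} (hf : ContH l I f) :
    ContH k I f := fun s hs =>
  squeeze_zero (fun _ => HSq_nonneg _ _) (fun _ => HSq_mono h _) (hf s hs)

namespace MemH

variable {f g : ℝ → ℝ}

lemma hasDerivAt (hf : MemH 1 f) (x : ℝ) : HasDerivAt f (deriv f x) x :=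
  (hf.1.differentiable (by norm_num) x).hasDerivAt

lemma continuous_deriv (hf : MemH 1 f) : Continuous (deriv f) :=
  hf.1.continuous_deriv (by norm_num)

lemma integrable_sq (hf : MemH 1 f) : Integrable fun x => f x ^ 2 := by
  simpa using hf.2 0 (by norm_num)

lemma integrable_deriv_sq (hf : MemH 1 f) : Integrable fun x => deriv f x ^ 2 := by
  simpa using hf.2 1 le_rfl

lemma memLp (hf : MemH 1 f) : MemLp f 2 :=
  (memLp_two_iff_integrable_sq hf.1.continuous.aestronglyMeasurable).2 hf.integrable_sq

lemma memLp_deriv (hf : MemH 1 f) : MemLp (deriv f) 2 :=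
  (memLp_two_iff_integrable_sq hf.continuous_deriv.aestronglyMeasurable).2
    hf.integrable_deriv_sq

lemma sub (hf : MemH 1 f) (hg : MemH 1 g) : MemH 1 fun x => f x - g x := by
  refine ⟨hf.1.sub hg.1, fun j hj => ?_⟩
  interval_cases j
  · simpa using (hf.memLp.sub hg.memLp).integrable_sq
  · have : deriv (fun x => f x - g x) = deriv f - deriv g :=
      funext fun x => ((hf.hasDerivAt x).sub (hg.hasDerivAt x)).deriv
    simpa [this] using (hf.memLp_deriv.sub hg.memLp_deriv).integrable_sq

lemma hasDerivAt_sq (hf : MemH 1 f) (x : ℝ) :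
    HasDerivAt (fun y => f y ^ 2) (2 * (f x * deriv f x)) x :=
  ((hf.hasDerivAt x).pow 2).congr_deriv (by push_cast; ring)

lemma integrable_deriv_of_sq (hf : MemH 1 f) :
    Integrable fun x => 2 * (f x * deriv f x) :=
  (hf.memLp.integrable_mul hf.memLp_deriv).const_mul 2

lemma tendsto_sq_atBot (hf : MemH 1 f) : Tendsto (fun x => f x ^ 2) atBot (nhds 0) :=
  tendsto_zero_of_hasDerivAt_of_integrableOn_Iic (a := 0) (fun x _ => hf.hasDerivAt_sq x)
    hf.integrable_deriv_of_sq.integrableOn hf.integrable_sq.integrableOn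

lemma tendsto_sq_atTop (hf : MemH 1 f) : Tendsto (fun x => f x ^ 2) atTop (nhds 0) :=
  tendsto_zero_of_hasDerivAt_of_integrableOn_Ioi (a := 0) (fun x _ => hf.hasDerivAt_sq x)
    hf.integrable_deriv_of_sq.integrableOn hf.integrable_sq.integrableOn

/-- The Sobolev embedding `H¹(ℝ) ⊆ L^∞(ℝ)`. -/
lemma sq_le_HSq (hf : MemH 1 f) (x : ℝ) : f x ^ 2 ≤ HSq 1 f := by
  have h := integral_Iic_of_hasDerivAt_of_tendsto' (a := x) (fun y _ => hf.hasDerivAt_sq y)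
    hf.integrable_deriv_of_sq.integrableOn hf.tendsto_sq_atBot
  rw [sub_zero] at h
  have hi : Integrable fun y => f y ^ 2 + deriv f y ^ 2 :=
    hf.integrable_sq.add hf.integrable_deriv_sq
  calc f x ^ 2 = ∫ y in Iic x, 2 * (f y * deriv f y) := h.symm
    _ ≤ ∫ y in Iic x, (f y ^ 2 + deriv f y ^ 2) :=
      integral_mono hf.integrable_deriv_of_sq.integrableOn hi.integrableOn
        fun y => by nlinarith [sq_nonneg (f y - deriv f y)]
    _ ≤ ∫ y, (f y ^ 2 + deriv f y ^ 2) :=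
      setIntegral_le_integral hi (ae_of_all _ fun y => by positivity)
    _ = HSq 1 f := by
      rw [HSq_one, integral_add hf.integrable_sq hf.integrable_deriv_sq]

lemma exists_pos_le_add_one (hf : MemH 1 f) (hpos : ∀ x, 0 < f x + 1) :
    ∃ c > 0, ∀ x, c ≤ f x + 1 := by
  have hco : ∀ᶠ x in cocompact ℝ, f x ^ 2 < 1 / 4 := by
    rw [cocompact_eq_atBot_atTop]
    have h : (0 : ℝ) < 1 / 4 := by norm_num
    exact eventually_sup.2 ⟨hf.tendsto_sq_atBot.eventually (gt_mem_nhds h),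
      hf.tendsto_sq_atTop.eventually (gt_mem_nhds h)⟩
  obtain ⟨K, hK, hKf⟩ := mem_cocompact.1 hco
  have hout : ∀ x ∉ K, 1 / 2 ≤ f x + 1 := fun x hx => by
    have : f x ^ 2 < 1 / 4 := hKf hx
    nlinarith
  rcases K.eq_empty_or_nonempty with rfl | hne
  · exact ⟨1 / 2, by norm_num, fun x => hout x (notMem_empty x)⟩
  obtain ⟨x₀, -, hx₀⟩ := hK.exists_isMinOn hne
    (hf.1.continuous.add continuous_const).continuousOn
  refine ⟨min (1 / 2) (f x₀ + 1), lt_min (by norm_num) (hpos x₀), fun x => ?_⟩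
  by_cases hx : x ∈ K
  · exact (min_le_right _ _).trans (hx₀ hx)
  · exact (min_le_left _ _).trans (hout x hx)

end MemH

/-- `f` belongs to `C⁰(I; H¹(ℝ))`. -/
def MemCH1 (I : Set ℝ) (f : ℝ → ℝ → ℝ) : Prop :=
  (∀ t ∈ I, MemH 1 (f t)) ∧ ContH 1 I f

lemma RegH.memCH1 {I : Set ℝ} {f : ℝ → ℝ → ℝ} (hf : RegH 2 I f) : MemCH1 I f :=
  ⟨fun t ht => (hf.1 t ht).mono one_le_two, hf.2.1.mono one_le_two⟩

lemma RegH.memCH1_pt {I : Set ℝ} {f : ℝ → ℝ → ℝ} (hf : RegH 2 I f) : MemCH1 I (pt f) :=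
  ⟨hf.2.2.2.1, hf.2.2.2.2⟩

namespace MemCH1

variable {I : Set ℝ} {f : ℝ → ℝ → ℝ}

lemma eventually_abs_sub_lt (hf : MemCH1 I f) {s : ℝ} (hs : s ∈ I) {ε : ℝ} (hε : 0 < ε) :
    ∀ᶠ t in nhdsWithin s I, ∀ x, |f t x - f s x| < ε := by
  filter_upwards [(hf.2 s hs).eventually (gt_mem_nhds (pow_pos hε 2)), self_mem_nhdsWithin]
    with t ht htI x
  exact abs_lt_of_sq_lt_sq
    ((((hf.1 t htI).sub (hf.1 s hs)).sq_le_HSq x).trans_lt ht) hε.le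

lemma continuousOn (hf : MemCH1 I f) :
    ContinuousOn (fun p : ℝ × ℝ => f p.1 p.2) (I ×ˢ univ) := by
  rintro ⟨s, y⟩ ⟨hs, -⟩
  rw [ContinuousWithinAt, nhdsWithin_prod_eq, nhdsWithin_univ, Metric.tendsto_nhds]
  intro ε hε
  have h₂ := Metric.tendsto_nhds.1 ((hf.1 s hs).1.continuous.tendsto y) (ε / 2) (half_pos hε)
  filter_upwards [(hf.eventually_abs_sub_lt hs (half_pos hε)).prod_mk h₂] with p hp
  have h1 := hp.1 p.2
  have h2 := hp.2
  rw [Real.dist_eq] at h2 ⊢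
  calc |f p.1 p.2 - f s y| ≤ |f p.1 p.2 - f s p.2| + |f s p.2 - f s y| := abs_sub_le _ _ _
    _ < ε := by linarith

lemma exists_bound (hf : MemCH1 I f) (hI : IsCompact I) :
    ∃ C, ∀ t ∈ I, (∫ x, f t x ^ 2) ≤ C ∧ ∀ x, |f t x| ≤ C := by
  refine hI.induction_on (p := fun J => ∃ C, ∀ t ∈ J, (∫ x, f t x ^ 2) ≤ C ∧ ∀ x, |f t x| ≤ C)
    ⟨0, fun _ h => h.elim⟩ (fun J K hJK ⟨C, hC⟩ => ⟨C, fun t ht => hC t (hJK ht)⟩) ?_ ?_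
  · rintro J K ⟨C, hC⟩ ⟨D, hD⟩
    refine ⟨max C D, fun t ht => ht.elim (fun h => ?_) fun h => ?_⟩
    · exact ⟨(hC t h).1.trans (le_max_left _ _), fun x => ((hC t h).2 x).trans (le_max_left _ _)⟩
    · exact ⟨(hD t h).1.trans (le_max_right _ _),
        fun x => ((hD t h).2 x).trans (le_max_right _ _)⟩
  · intro s hs
    have hev := (hf.2 s hs).eventually (gt_mem_nhds (zero_lt_one' ℝ))
    refine ⟨I ∩ {t | HSq 1 (fun x => f t x - f s x) < 1},
      inter_mem self_mem_nhdsWithin hev,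
      max (2 + 2 * ∫ x, f s x ^ 2) (1 + (1 + HSq 1 (f s))), fun t ⟨htI, ht⟩ => ⟨?_, fun x => ?_⟩⟩
    · refine le_max_of_le_left ?_
      have hd := (hf.1 t htI).sub (hf.1 s hs)
      have h1 : (∫ x, (f t x - f s x) ^ 2) ≤ 1 := by
        have h0 : 0 ≤ ∫ x, deriv (fun x => f t x - f s x) x ^ 2 :=
          integral_nonneg fun _ => sq_nonneg _
        have ht' : HSq 1 (fun x => f t x - f s x) < 1 := ht
        rw [HSq_one] at ht'
        linarith
      calc (∫ x, f t x ^ 2) ≤ ∫ x, (2 * (f t x - f s x) ^ 2 + 2 * f s x ^ 2) :=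
            integral_mono (hf.1 t htI).integrable_sq
              ((hd.integrable_sq.const_mul 2).add ((hf.1 s hs).integrable_sq.const_mul 2))
              fun x => by
                have := sq_nonneg (f t x - 2 * f s x)
                dsimp only
                nlinarith
        _ = 2 * (∫ x, (f t x - f s x) ^ 2) + 2 * ∫ x, f s x ^ 2 := by
            rw [integral_add (hd.integrable_sq.const_mul 2)
              ((hf.1 s hs).integrable_sq.const_mul 2), MeasureTheory.integral_const_mul, MeasureTheory.integral_const_mul]
        _ ≤ _ := by linarith
    · refine le_max_of_le_right ?_
      have h1 : |f t x - f s x| < 1 := abs_lt_of_sq_lt_sq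
        (((((hf.1 t htI).sub (hf.1 s hs)).sq_le_HSq x).trans_lt ht).trans_eq (one_pow 2).symm)
        zero_le_one
      have h2 : |f s x| ≤ 1 + HSq 1 (f s) := by
        have := (hf.1 s hs).sq_le_HSq x
        nlinarith [sq_abs (f s x), sq_nonneg (|f s x| - 1)]
      have h3 := abs_sub_abs_le_abs_sub (f t x) (f s x)
      linarith

lemma exists_pos_le_add_one (hf : MemCH1 I f) (hI : IsCompact I)
    (hpos : ∀ t ∈ I, ∀ x, 0 < f t x + 1) : ∃ c > 0, ∀ t ∈ I, ∀ x, c ≤ f t x + 1 := by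
  refine hI.induction_on (p := fun J => ∃ c > 0, ∀ t ∈ J, ∀ x, c ≤ f t x + 1)
    ⟨1, one_pos, fun _ h => h.elim⟩
    (fun J K hJK ⟨c, hc, h⟩ => ⟨c, hc, fun t ht => h t (hJK ht)⟩) ?_ ?_
  · rintro J K ⟨c, hc, h⟩ ⟨d, hd, h'⟩
    exact ⟨min c d, lt_min hc hd, fun t ht x => ht.elim
      (fun ht => (min_le_left _ _).trans (h t ht x))
      fun ht => (min_le_right _ _).trans (h' t ht x)⟩
  · intro s hs
    obtain ⟨c, hc, h⟩ := (hf.1 s hs).exists_pos_le_add_one (hpos s hs)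
    refine ⟨_, hf.eventually_abs_sub_lt hs (half_pos hc), c / 2, half_pos hc, fun t ht x => ?_⟩
    have h1 := (abs_lt.1 (ht x)).1
    have h2 := h x
    linarith

end MemCH1

/-- Lebesgue measure on the strip `(0,T) × ℝ`, as a product measure. -/
abbrev stripMeasure (T : ℝ) : Measure (ℝ × ℝ) := (volume.restrict (Ioo 0 T)).prod volume

lemma stripMeasure_eq (T : ℝ) :
    stripMeasure T = (volume : Measure (ℝ × ℝ)).restrict (Ioo 0 T ×ˢ univ) := by
  rw [Measure.volume_eq_prod, ← Measure.prod_restrict, Measure.restrict_univ]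

lemma ae_stripMeasure (T : ℝ) : ∀ᵐ p ∂stripMeasure T, p.1 ∈ Icc 0 T := by
  rw [stripMeasure_eq]
  filter_upwards [ae_restrict_mem (measurableSet_Ioo.prod MeasurableSet.univ)] with p hp
  exact Ioo_subset_Icc_self hp.1

lemma aestronglyMeasurable_stripMeasure {T : ℝ} {f : ℝ × ℝ → ℝ}
    (hf : ContinuousOn f (Icc 0 T ×ˢ univ)) : AEStronglyMeasurable f (stripMeasure T) := by
  rw [stripMeasure_eq]
  exact (hf.mono (prod_mono_left Ioo_subset_Icc_self)).aestronglyMeasurable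
    (measurableSet_Ioo.prod MeasurableSet.univ)

lemma MemCH1.memLp {T : ℝ} {f : ℝ → ℝ → ℝ} (hf : MemCH1 (Icc 0 T) f) :
    MemLp (fun p : ℝ × ℝ => f p.1 p.2) 2 (stripMeasure T) := by
  have hm := aestronglyMeasurable_stripMeasure hf.continuousOn
  rw [memLp_two_iff_integrable_sq hm]
  obtain ⟨C, hC⟩ := hf.exists_bound isCompact_Icc
  have hm2 := hm.pow 2
  have hT : ∀ᵐ t ∂(volume.restrict (Ioo 0 T)), t ∈ Icc 0 T := by
    filter_upwards [ae_restrict_mem measurableSet_Ioo] with t ht using Ioo_subset_Icc_self ht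
  refine (integrable_prod_iff hm2).2 ⟨?_, ?_⟩
  · filter_upwards [hT] with t ht using (hf.1 t ht).integrable_sq
  · refine Integrable.of_bound hm2.norm.integral_prod_right' C ?_
    filter_upwards [hT] with t ht
    rw [Real.norm_of_nonneg (integral_nonneg fun _ => norm_nonneg _)]
    simpa using (hC t ht).1

lemma exists_abs_one_sub_rpow_le {γ c : ℝ} (hγ : 0 < γ) (hc : 0 < c) :
    ∃ C, 0 ≤ C ∧ ∀ w, c ≤ w → |1 - w ^ (-γ)| ≤ C * |w - 1| := by
  set d := min c 1
  have hd : 0 < d := lt_min hc one_pos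
  have hC : 0 ≤ γ * d ^ (-γ - 1) := mul_nonneg hγ.le (Real.rpow_nonneg hd.le _)
  refine ⟨γ * d ^ (-γ - 1), hC, fun w hw => ?_⟩
  have hderiv : ∀ x ∈ Ici d,
      HasDerivWithinAt (fun x : ℝ => x ^ (-γ)) (-γ * x ^ (-γ - 1)) (Ici d) x := fun x hx =>
    (Real.hasDerivAt_rpow_const (Or.inl (hd.trans_le hx).ne')).hasDerivWithinAt
  have hbound : ∀ x ∈ Ici d, ‖-γ * x ^ (-γ - 1)‖ ≤ γ * d ^ (-γ - 1) := fun x hx => by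
    rw [norm_mul, norm_neg, Real.norm_of_nonneg hγ.le,
      Real.norm_of_nonneg (Real.rpow_nonneg (hd.le.trans hx) _)]
    exact mul_le_mul_of_nonneg_left
      (Real.rpow_le_rpow_of_nonpos hd hx (by linarith)) hγ.le
  have h := (convex_Ici d).norm_image_sub_le_of_norm_hasDerivWithin_le hderiv hbound
    (mem_Ici.2 (min_le_right c 1)) (mem_Ici.2 ((min_le_left c 1).trans hw))
  rw [Real.one_rpow, norm_sub_rev] at h
  exact h

lemma hasDerivAt_potential {γ w : ℝ} (hγ : 1 < γ) (hw : 0 < w) :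
    HasDerivAt (fun w : ℝ => (w ^ (1 - γ) - 1) / (γ - 1) + w - 1) (1 - w ^ (-γ)) w := by
  have h : HasDerivAt (fun w : ℝ => w ^ (1 - γ)) ((1 - γ) * w ^ (1 - γ - 1)) w :=
    Real.hasDerivAt_rpow_const (Or.inl hw.ne')
  refine ((((h.sub_const 1).div_const (γ - 1)).add (hasDerivAt_id w)).sub_const 1).congr_deriv ?_
  have : γ - 1 ≠ 0 := by linarith
  rw [show 1 - γ - 1 = -γ by ring]
  field_simp
  ring

lemma exists_abs_potential_le {γ c : ℝ} (hγ : 1 < γ) (hc : 0 < c) :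
    ∃ C, ∀ w, c ≤ w → |(w ^ (1 - γ) - 1) / (γ - 1) + w - 1| ≤ C * (w - 1) ^ 2 := by
  obtain ⟨C, hC, h⟩ := exists_abs_one_sub_rpow_le (one_pos.trans hγ) (lt_min hc one_pos)
  refine ⟨C, fun w hw => ?_⟩
  have hmem : ∀ x ∈ uIcc 1 w, min c 1 ≤ x := fun x hx =>
    (le_min (min_le_right _ _) ((min_le_left _ _).trans hw)).trans hx.1
  have hb : ∀ x ∈ uIcc 1 w, ‖1 - x ^ (-γ)‖ ≤ C * |w - 1| := fun x hx =>
    (h x (hmem x hx)).trans (mul_le_mul_of_nonneg_left (abs_sub_left_of_mem_uIcc hx) hC)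
  have := (convex_uIcc 1 w).norm_image_sub_le_of_norm_hasDerivWithin_le
    (fun x hx => (hasDerivAt_potential hγ
      ((lt_min hc one_pos).trans_le (hmem x hx))).hasDerivWithinAt)
    hb left_mem_uIcc right_mem_uIcc
  simpa [mul_assoc, abs_mul_abs_self, ← sq] using this

lemma integrable_mul_of_continuousOn {T C : ℝ} {b G : ℝ × ℝ → ℝ}
    (hG : Integrable G (stripMeasure T)) (hb : ContinuousOn b (Icc 0 T ×ˢ univ))
    (hC : ∀ p : ℝ × ℝ, p.1 ∈ Icc 0 T → |b p| ≤ C) :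
    Integrable (fun p => b p * G p) (stripMeasure T) :=
  hG.bdd_mul (aestronglyMeasurable_stripMeasure hb)
    (by filter_upwards [ae_stripMeasure T] with p hp using hC p hp)

lemma integrable_mul_comp_fst {T : ℝ} {G : ℝ × ℝ → ℝ} {φ : ℝ → ℝ}
    (hG : Integrable G (stripMeasure T)) (hφ : Continuous φ) :
    Integrable (fun p => G p * φ p.1) (stripMeasure T) := by
  obtain ⟨C, hC⟩ := isCompact_Icc.exists_bound_of_continuousOn (hφ.continuousOn (s := Icc 0 T))
  simpa only [mul_comm] using
    integrable_mul_of_continuousOn (b := fun p => φ p.1) hG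
      (hφ.comp continuous_fst).continuousOn fun p hp => hC p.1 hp

lemma integrable_integral_mul {T : ℝ} {G : ℝ → ℝ → ℝ} {φ : ℝ → ℝ}
    (hG : Integrable (fun p : ℝ × ℝ => G p.1 p.2) (stripMeasure T)) (hφ : Continuous φ) :
    IntegrableOn (fun t => (∫ x, G t x) * φ t) (Ioo 0 T) := by
  simpa only [IntegrableOn, MeasureTheory.integral_mul_const] using
    (integrable_mul_comp_fst hG hφ).integral_prod_left

/-- Differentiation under the integral sign, in the distributional sense in time. -/
lemma integral_mul_deriv_eq_neg {T : ℝ} (hT : 0 < T) {E E' : ℝ → ℝ → ℝ} {φ : ℝ → ℝ}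
    (hE : Integrable (fun p : ℝ × ℝ => E p.1 p.2) (stripMeasure T))
    (hE' : Integrable (fun p : ℝ × ℝ => E' p.1 p.2) (stripMeasure T))
    (hcont : ContinuousOn (fun p : ℝ × ℝ => E' p.1 p.2) (Icc 0 T ×ˢ univ))
    (hderiv : ∀ t ∈ Icc 0 T, ∀ x, HasDerivAt (fun s => E s x) (E' t x) t)
    (hφ : ContDiff ℝ 1 φ) (h0 : φ 0 = 0) (h1 : φ T = 0) :
    ∫ t in Ioo 0 T, (∫ x, E t x) * deriv φ t = -∫ t in Ioo 0 T, (∫ x, E' t x) * φ t := by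
  have hdφ : Continuous (deriv φ) := hφ.continuous_deriv le_rfl
  have i1 := integrable_mul_comp_fst hE hdφ
  have i2 := integrable_mul_comp_fst hE' hφ.continuous
  have hzero : ∀ x, ∫ t in Ioo 0 T, (E t x * deriv φ t + E' t x * φ t) = 0 := fun x => by
    have hEx : ContinuousOn (fun t => E t x) (Icc 0 T) :=
      fun t ht => (hderiv t ht x).continuousAt.continuousWithinAt
    have hEx' : ContinuousOn (fun t => E' t x) (Icc 0 T) :=
      hcont.comp (f := fun t => (t, x)) (by fun_prop) fun t ht => ⟨ht, mem_univ _⟩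
    have hd : ∀ t ∈ uIcc 0 T,
        HasDerivAt (fun t => E t x * φ t) (E t x * deriv φ t + E' t x * φ t) t := fun t ht => by
      rw [uIcc_of_le hT.le] at ht
      rw [add_comm]
      exact (hderiv t ht x).mul (hφ.differentiable one_ne_zero t).hasDerivAt
    have hi : IntervalIntegrable (fun t => E t x * deriv φ t + E' t x * φ t) volume 0 T := by
      apply ContinuousOn.intervalIntegrable
      rw [uIcc_of_le hT.le]
      exact (hEx.mul hdφ.continuousOn).add (hEx'.mul hφ.continuous.continuousOn)
    rw [← integral_Ioc_eq_integral_Ioo, ← integral_of_le hT.le,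
      integral_eq_sub_of_hasDerivAt hd hi, h0, h1]
    ring
  have hsum : ∫ t in Ioo 0 T, ∫ x, (E t x * deriv φ t + E' t x * φ t) = 0 := by
    rw [integral_integral_swap (i1.add i2)]
    simp [hzero]
  rw [← sub_eq_zero, sub_neg_eq_add,
    ← integral_add (integrable_integral_mul hE hdφ) (integrable_integral_mul hE' hφ.continuous)]
  refine (MeasureTheory.integral_congr_ae ?_).trans hsum
  filter_upwards [i1.prod_right_ae, i2.prod_right_ae] with t ht1 ht2
  rw [integral_add ht1 ht2, MeasureTheory.integral_mul_const, MeasureTheory.integral_mul_const]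

/-- The basic energy identity, in the distributional sense in time on `(0,T)`:
`d/dt ∫ (u²/2 + (τv/2μ)S² + (v^(1-γ)-1)/(γ-1) + v - 1) dx + ∫ (v/μ)S² dx
  = ((4a+1)τ/(2μ)) ∫ u_x S² dx`,
tested against any `φ ∈ C_c^∞((0,T))`. -/
theorem energy_identity
    (a μ γ τ T : ℝ) (ha : a ∈ Icc (-1 : ℝ) 1) (hμ : 0 < μ) (hγ : 1 < γ)
    (hτ : 0 < τ) (hT : 0 < T)
    (v u S : ℝ → ℝ → ℝ)
    (hregv : RegH 2 (Icc 0 T) (fun t x => v t x - 1))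
    (hregu : RegH 2 (Icc 0 T) u) (hregS : RegH 2 (Icc 0 T) S)
    (hvpos : ∀ t ∈ Icc (0 : ℝ) T, ∀ x : ℝ, 0 < v t x)
    (hsol : ∀ t ∈ Icc (0 : ℝ) T, ∀ x : ℝ, RelaxedSystem a μ γ τ v u S t x) :
    ∀ φ : ℝ → ℝ, ContDiff ℝ (⊤ : ℕ∞) φ → HasCompactSupport φ → tsupport φ ⊆ Ioo 0 T →
      -(∫ t in Ioo (0 : ℝ) T,
          (∫ x : ℝ, (u t x ^ 2 / 2 + τ * v t x / (2 * μ) * S t x ^ 2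
            + (v t x ^ (1 - γ) - 1) / (γ - 1) + v t x - 1)) * deriv φ t)
        + (∫ t in Ioo (0 : ℝ) T, (∫ x : ℝ, v t x / μ * S t x ^ 2) * φ t)
        = ∫ t in Ioo (0 : ℝ) T,
            ((4 * a + 1) * τ / (2 * μ) * ∫ x : ℝ, px u t x * S t x ^ 2) * φ t := by
  intro φ hφ _ hsupp
  have hv' : MemCH1 (Icc 0 T) (pt v) := by
    have h := hregv.memCH1_pt
    rwa [show pt (fun t x => v t x - 1) = pt v from
      funext fun t => funext fun x => by simp [pt]] at h
  have hv := hregv.memCH1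
  have hu := hregu.memCH1
  have hS := hregS.memCH1
  have hu' := hregu.memCH1_pt
  have hS' := hregS.memCH1_pt
  have hvd : ∀ t ∈ Icc 0 T, ∀ x, HasDerivAt (fun s => v s x) (pt v t x) t := fun t ht x => by
    have h := (hregv.2.2.1 x t ht).add_const 1
    simp only [sub_add_cancel] at h
    exact h.hasDerivAt
  have hvc : ContinuousOn (fun p : ℝ × ℝ => v p.1 p.2) (Icc 0 T ×ˢ univ) :=
    (hv.continuousOn.add (continuousOn_const (c := (1 : ℝ)))).congr fun p _ => by simp
  have hvne : ∀ p ∈ Icc 0 T ×ˢ (univ : Set ℝ), v p.1 p.2 ≠ 0 := fun p hp =>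
    (hvpos p.1 hp.1 p.2).ne'
  obtain ⟨c, hc, hcv⟩ := hv.exists_pos_le_add_one isCompact_Icc (by simpa using hvpos)
  simp only [sub_add_cancel] at hcv
  obtain ⟨Mv, hMv⟩ := hv.exists_bound isCompact_Icc
  obtain ⟨Mw, hMw⟩ := hv'.exists_bound isCompact_Icc
  obtain ⟨C₁, -, hC₁⟩ := exists_abs_one_sub_rpow_le (one_pos.trans hγ) hc
  obtain ⟨C₂, hC₂⟩ := exists_abs_potential_le hγ hc
  have hvb : ∀ p : ℝ × ℝ, p.1 ∈ Icc 0 T → |v p.1 p.2| ≤ Mv + 1 := fun p hp => by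
    have h1 := (hMv p.1 hp).2 p.2
    have h2 := abs_sub_abs_le_abs_sub (v p.1 p.2) 1
    rw [abs_one] at h2
    linarith
  -- Integrability on the strip of the individual terms.
  have iuu : Integrable (fun p : ℝ × ℝ => u p.1 p.2 ^ 2) (stripMeasure T) :=
    hu.memLp.integrable_sq
  have iSS : Integrable (fun p : ℝ × ℝ => S p.1 p.2 ^ 2) (stripMeasure T) :=
    hS.memLp.integrable_sq
  have ivSS : Integrable (fun p : ℝ × ℝ => v p.1 p.2 * S p.1 p.2 ^ 2) (stripMeasure T) :=
    integrable_mul_of_continuousOn iSS hvc hvb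
  have iwSS : Integrable (fun p : ℝ × ℝ => pt v p.1 p.2 * S p.1 p.2 ^ 2) (stripMeasure T) :=
    integrable_mul_of_continuousOn iSS hv'.continuousOn fun p hp => (hMw p.1 hp).2 p.2
  have iuut : Integrable (fun p : ℝ × ℝ => u p.1 p.2 * pt u p.1 p.2) (stripMeasure T) :=
    hu.memLp.integrable_mul hu'.memLp
  have ivSSt : Integrable (fun p : ℝ × ℝ => v p.1 p.2 * (S p.1 p.2 * pt S p.1 p.2))
      (stripMeasure T) :=
    integrable_mul_of_continuousOn (hS.memLp.integrable_mul hS'.memLp) hvc hvb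
  have iuS : Integrable (fun p : ℝ × ℝ => u p.1 p.2 * S p.1 p.2) (stripMeasure T) :=
    hu.memLp.integrable_mul hS.memLp
  have hpc : ContinuousOn (fun p : ℝ × ℝ => 1 - v p.1 p.2 ^ (-γ)) (Icc 0 T ×ˢ univ) :=
    continuousOn_const.sub (hvc.rpow_const fun p hp => Or.inl (hvne p hp))
  have hqc : ContinuousOn (fun p : ℝ × ℝ =>
      (v p.1 p.2 ^ (1 - γ) - 1) / (γ - 1) + v p.1 p.2 - 1) (Icc 0 T ×ˢ univ) :=
    ((((hvc.rpow_const fun p hp => Or.inl (hvne p hp)).sub continuousOn_const).div_const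
      _).add hvc).sub continuousOn_const
  have hpLp : MemLp (fun p : ℝ × ℝ => 1 - v p.1 p.2 ^ (-γ)) 2 (stripMeasure T) := by
    refine hv.memLp.of_le_mul (c := C₁) (aestronglyMeasurable_stripMeasure hpc) ?_
    filter_upwards [ae_stripMeasure T] with p hp using hC₁ _ (hcv p.1 hp p.2)
  have ipw : Integrable (fun p : ℝ × ℝ => (1 - v p.1 p.2 ^ (-γ)) * pt v p.1 p.2)
      (stripMeasure T) := hpLp.integrable_mul hv'.memLp
  have iup : Integrable (fun p : ℝ × ℝ => u p.1 p.2 * (1 - v p.1 p.2 ^ (-γ)))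
      (stripMeasure T) := hu.memLp.integrable_mul hpLp
  have iq : Integrable (fun p : ℝ × ℝ => (v p.1 p.2 ^ (1 - γ) - 1) / (γ - 1) + v p.1 p.2 - 1)
      (stripMeasure T) := by
    refine (hv.memLp.integrable_sq.const_mul C₂).mono' (aestronglyMeasurable_stripMeasure hqc) ?_
    filter_upwards [ae_stripMeasure T] with p hp using hC₂ _ (hcv p.1 hp p.2)
  set E : ℝ → ℝ → ℝ := fun t x => u t x ^ 2 / 2 + τ * v t x / (2 * μ) * S t x ^ 2
            + (v t x ^ (1 - γ) - 1) / (γ - 1) + v t x - 1 with hEdef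
  set E' : ℝ → ℝ → ℝ := fun t x => u t x * pt u t x + τ / (2 * μ) * (pt v t x * S t x ^ 2)
      + τ / μ * (v t x * (S t x * pt S t x)) + (1 - v t x ^ (-γ)) * pt v t x with hE'def
  have iE : Integrable (fun p : ℝ × ℝ => E p.1 p.2) (stripMeasure T) := by
    refine (((iuu.div_const 2).add (ivSS.const_mul (τ / (2 * μ)))).add iq).congr
      (ae_of_all _ fun p => ?_)
    simp only [hEdef, Pi.add_apply]
    ring
  have iE' : Integrable (fun p : ℝ × ℝ => E' p.1 p.2) (stripMeasure T) :=
    ((iuut.add (iwSS.const_mul _)).add (ivSSt.const_mul _)).add ipw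
  have hE'c : ContinuousOn (fun p : ℝ × ℝ => E' p.1 p.2) (Icc 0 T ×ˢ univ) :=
    (((hu.continuousOn.mul hu'.continuousOn).add
      (continuousOn_const.mul (hv'.continuousOn.mul (hS.continuousOn.pow 2)))).add
      (continuousOn_const.mul (hvc.mul (hS.continuousOn.mul hS'.continuousOn)))).add
      (hpc.mul hv'.continuousOn)
  have hEd : ∀ t ∈ Icc 0 T, ∀ x, HasDerivAt (fun s => E s x) (E' t x) t := fun t ht x => by
    have h1 : HasDerivAt (fun s => u s x) (pt u t x) t := (hregu.2.2.1 x t ht).hasDerivAt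
    have h2 : HasDerivAt (fun s => S s x) (pt S t x) t := (hregS.2.2.1 x t ht).hasDerivAt
    have h3 := hvd t ht x
    have h4 := (hasDerivAt_potential hγ (hvpos t ht x)).comp t h3
    have h5 := (((h1.pow 2).div_const 2).add
      (((h3.mul (h2.pow 2)).const_mul (τ / (2 * μ))))).add h4
    refine (h5.congr_of_eventuallyEq (Eventually.of_forall fun s => ?_)).congr_deriv ?_
    · simp only [hEdef, Pi.add_apply, Pi.mul_apply, Pi.pow_apply, Function.comp_apply]
      ring
    · simp only [hE'def, Pi.pow_apply]
      push_cast
      field_simp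
      ring
  have hφ0 : ∀ t ∉ Ioo 0 T, φ t = 0 := fun t ht =>
    image_eq_zero_of_notMem_tsupport fun h => ht (hsupp h)
  rw [integral_mul_deriv_eq_neg hT iE iE' hE'c hEd (hφ.of_le (by exact_mod_cast le_top))
    (hφ0 0 (by simp)) (hφ0 T (by simp)), neg_neg]
  have iD : Integrable (fun p : ℝ × ℝ => v p.1 p.2 / μ * S p.1 p.2 ^ 2) (stripMeasure T) :=
    (ivSS.div_const μ).congr (ae_of_all _ fun p => by ring)
  rw [← integral_add (integrable_integral_mul iE' hφ.continuous)
    (integrable_integral_mul iD hφ.continuous)]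
  refine MeasureTheory.integral_congr_ae ?_
  filter_upwards [iE'.prod_right_ae, iD.prod_right_ae, iwSS.prod_right_ae, iuS.prod_right_ae,
    iup.prod_right_ae, ae_restrict_mem measurableSet_Ioo] with t jE' jD jR juS jup ht
  replace ht := Ioo_subset_Icc_self ht
  have hsys := hsol t ht
  have hpx : ∀ x, px u t x = pt v t x := fun x => (hsys x).1.symm
  simp only [hpx]
  rw [← add_mul, ← integral_add jE' jD, ← MeasureTheory.integral_const_mul]
  congr 1
  -- The integrand is the space derivative of an integrable flux.
  have jL : Integrable fun x => E' t x + v t x / μ * S t x ^ 2 := jE'.add jD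
  have jR' := jR.const_mul ((4 * a + 1) * τ / (2 * μ))
  rw [← sub_eq_zero, ← integral_sub jL jR']
  refine integral_eq_zero_of_hasDerivAt_of_integrable (fun x => ?_)
    (jL.sub jR') (juS.add jup)
  have d1 : HasDerivAt (u t) (px u t x) x := (hu.1 t ht).hasDerivAt x
  have d2 : HasDerivAt (S t) (px S t x) x := (hS.1 t ht).hasDerivAt x
  have d3 : DifferentiableAt ℝ (fun y => v t y ^ (-γ)) x := by
    have h := ((hv.1 t ht).hasDerivAt x).differentiableAt.add_const 1
    simp only [sub_add_cancel] at h
    exact h.rpow_const (Or.inl (hvpos t ht x).ne')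
  refine ((d1.mul d2).add (d1.mul (d3.hasDerivAt.const_sub 1))).congr_deriv ?_
  obtain ⟨e1, e2, e3⟩ := hsys x
  have hvx := (hvpos t ht x).ne'
  have e3' : τ * (v t x * pt S t x) = 2 * a * τ * S t x * pt v t x - v t x * S t x
      + μ * pt v t x := by
    rw [← e1] at e3
    field_simp at e3
    linear_combination e3
  have e4 : τ / μ * (v t x * (S t x * pt S t x)) = (2 * a * τ * S t x * pt v t x
      - v t x * S t x + μ * pt v t x) * S t x / μ := by
    rw [← e3']
    ring
  simp only [hE'def, e4, ← e1]
  rw [← e2]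
  field_simp
  ring
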